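/- For every nonzero complex number a, the 8-dimensional complex Lie algebra L(a) with basis e1,...,e8 and nonzero brackets [e2,e8] = a·e3, [e3,e8] = e2, [e4,e7] = e1, [e4,e8] = e1, [e5,e7] = e6, [e6,e7] = e5 (extended antisymmetrically and bilinearly) is isomorphic as a complex Lie algebra to L(1/a). -/

import Mathlib

/-- The bilinear antisymmetric extension of the bracket relations
`[e2,e8] = a•e3`, `[e3,e8] = e2`, `[e4,e7] = e1`, `[e4,e8] = e1`, `[e5,e7] = e6`,
`[e6,e7] = e5` (all other brackets of basis vectors zero) on an 8-dimensional space: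
the one-parameter family of solvable Lie algebras `G₍₁₆,₁₎(a)`, written in coordinates. -/
noncomputable def br (a : ℂ) (x y : Fin 8 → ℂ) : Fin 8 → ℂ :=
  ![(x 3 * y 6 - x 6 * y 3) + (x 3 * y 7 - x 7 * y 3),
    x 2 * y 7 - x 7 * y 2,
    a * (x 1 * y 7 - x 7 * y 1),
    0,
    x 5 * y 6 - x 6 * y 5,
    x 4 * y 6 - x 6 * y 4,
    0,
    0]

/-- The linear automorphism of `ℂ⁸` that exchanges the planes `⟨e2, e3⟩` and `⟨e5, e6⟩` and the
vectors `e7` and `e8`, rescaling some of the coordinates by `s`. -/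
noncomputable def swapEquiv (s : ℂ) (hs : s ≠ 0) : (Fin 8 → ℂ) ≃ₗ[ℂ] (Fin 8 → ℂ) where
  toFun x := ![s * x 0, s * x 4, x 5, x 3, s * x 1, x 2, s * x 7, s * x 6]
  invFun x := ![s⁻¹ * x 0, s⁻¹ * x 4, x 5, x 3, s⁻¹ * x 1, x 2, s⁻¹ * x 7, s⁻¹ * x 6]
  map_add' x y := by
    ext i
    fin_cases i <;> simp [mul_add]
  map_smul' c x := by
    ext i
    fin_cases i <;> simp [mul_left_comm]
  left_inv x := by
    ext i
    fin_cases i <;> simp [hs]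
  right_inv x := by
    ext i
    fin_cases i <;> simp [hs]

theorem swapEquiv_apply (s : ℂ) (hs : s ≠ 0) (x : Fin 8 → ℂ) :
    swapEquiv s hs x = ![s * x 0, s * x 4, x 5, x 3, s * x 1, x 2, s * x 7, s * x 6] :=
  rfl

/-- For every nonzero `a : ℂ`, the Lie algebra `L(a) = G₍₁₆,₁₎(a)` is isomorphic, as a
complex Lie algebra, to `L(1/a)`. -/
theorem G16_1_iso_inv (a : ℂ) (ha : a ≠ 0) :
    ∃ f : (Fin 8 → ℂ) ≃ₗ[ℂ] (Fin 8 → ℂ),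
      ∀ x y : Fin 8 → ℂ, f (br a x y) = br a⁻¹ (f x) (f y) := by
  obtain ⟨s, rfl⟩ := IsAlgClosed.exists_eq_mul_self a
  have hs : s ≠ 0 := left_ne_zero_of_mul ha
  refine ⟨swapEquiv s hs, fun x y => ?_⟩
  ext i
  fin_cases i <;> simp [swapEquiv_apply, br] <;> field_simp
  ring
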